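/- Ramanujan's identity: Li₂(1/4) + (1/3)·Li₂(1/9) = π²/18 + 2·(ln 2)·(ln 3) − 2·(ln 2)² − (2/3)·(ln 3)². -/

import Mathlib

open Real

/-- The dilogarithm, `Li₂(z) = ∑_{k=1}^∞ z^k / k²`. -/
noncomputable def Li2 (z : ℝ) : ℝ := ∑' k : ℕ, z ^ (k + 1) / ((k : ℝ) + 1) ^ 2

open Set Filter Topology

theorem summable_one_div_add_one_sq : Summable fun k : ℕ => 1 / ((k : ℝ) + 1) ^ 2 := by
  have h := (summable_nat_add_iff 1).2 hasSum_zeta_two.summable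
  simpa using h

theorem norm_Li2_term_le {z : ℝ} (hz : z ∈ Icc (-1 : ℝ) 1) (k : ℕ) :
    ‖z ^ (k + 1) / ((k : ℝ) + 1) ^ 2‖ ≤ 1 / ((k : ℝ) + 1) ^ 2 := by
  rw [norm_div, norm_pow, Real.norm_of_nonneg (by positivity : (0 : ℝ) ≤ ((k : ℝ) + 1) ^ 2)]
  gcongr
  exact pow_le_one₀ (norm_nonneg _) (abs_le.2 hz)

theorem hasSum_Li2 {z : ℝ} (hz : z ∈ Icc (-1 : ℝ) 1) :
    HasSum (fun k : ℕ => z ^ (k + 1) / ((k : ℝ) + 1) ^ 2) (Li2 z) :=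
  (Summable.of_norm_bounded summable_one_div_add_one_sq (norm_Li2_term_le hz)).hasSum

theorem continuousOn_Li2 : ContinuousOn Li2 (Icc (-1) 1) :=
  continuousOn_tsum (fun k => by fun_prop) summable_one_div_add_one_sq
    fun k _ hz => norm_Li2_term_le hz k

theorem Li2_zero : Li2 0 = 0 := by simp [Li2]

theorem Li2_one : Li2 1 = π ^ 2 / 6 := by
  have h := (hasSum_nat_add_iff' 1).2 hasSum_zeta_two
  refine (hasSum_Li2 (z := 1) (by simp)).unique ?_
  simpa using h

theorem Li2_sq {x : ℝ} (hx : x ∈ Icc (-1 : ℝ) 1) : Li2 (x ^ 2) = 2 * (Li2 x + Li2 (-x)) := by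
  have hx' : -x ∈ Icc (-1 : ℝ) 1 := ⟨by linarith [hx.2], by linarith [hx.1]⟩
  have hx2 : x ^ 2 ∈ Icc (-1 : ℝ) 1 := ⟨by nlinarith, by nlinarith [hx.1, hx.2]⟩
  have h := (hasSum_Li2 hx).add (hasSum_Li2 hx')
  have h2 := (hasSum_Li2 hx2).div_const 2
  have h3 := HasSum.even_add_odd
    (f := fun k : ℕ => x ^ (k + 1) / ((k : ℝ) + 1) ^ 2 + (-x) ^ (k + 1) / ((k : ℝ) + 1) ^ 2)
    (m := 0) (m' := Li2 (x ^ 2) / 2) ?_ ?_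
  · linarith [h.unique h3]
  · convert! hasSum_zero using 2 with k
    rw [Odd.neg_pow ⟨k, rfl⟩]
    ring
  · convert! h2 using 2 with k
    rw [Even.neg_pow ⟨k + 1, by ring⟩, ← pow_mul]
    push_cast
    have : (k : ℝ) + 1 ≠ 0 := by positivity
    rw [show 2 * k + 1 + 1 = 2 * (k + 1) by ring, show 2 * (k : ℝ) + 1 + 1 = 2 * (k + 1) by ring]
    field_simp
    ring

theorem Li2_neg_one : Li2 (-1) = -(π ^ 2 / 12) := by
  have h := Li2_sq (x := 1) (by simp)
  rw [one_pow, Li2_one] at h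
  linarith

theorem hasDerivAt_Li2 {z : ℝ} (hz : |z| < 1) (hz0 : z ≠ 0) :
    HasDerivAt Li2 (-log (1 - z) / z) z := by
  obtain ⟨r, hzr, hr1⟩ := exists_between hz
  have hr0 : 0 ≤ r := (abs_nonneg z).trans hzr.le
  have hd : HasDerivAt Li2 (∑' k : ℕ, z ^ k / ((k : ℝ) + 1)) z := by
    refine hasDerivAt_tsum_of_isPreconnected (t := Ioo (-r) r) (y₀ := 0)
      (summable_geometric_of_lt_one hr0 hr1) isOpen_Ioo isPreconnected_Ioo
      (g := fun (k : ℕ) (y : ℝ) => y ^ (k + 1) / ((k : ℝ) + 1) ^ 2)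
      (g' := fun (k : ℕ) (y : ℝ) => y ^ k / ((k : ℝ) + 1)) ?_ ?_ ?_ ?_ (abs_lt.1 hzr)
    · intro k y _
      have hk : (k : ℝ) + 1 ≠ 0 := by positivity
      convert! (hasDerivAt_pow (k + 1) y).div_const (((k : ℝ) + 1) ^ 2) using 1
      push_cast
      field_simp
    · intro k y hy
      rw [norm_div, norm_pow, Real.norm_of_nonneg (by positivity : (0 : ℝ) ≤ (k : ℝ) + 1)]
      refine (div_le_self (by positivity) (by linarith [k.cast_nonneg (α := ℝ)])).trans ?_
      exact pow_le_pow_left₀ (norm_nonneg _) (abs_lt.2 hy).le k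
    · exact ⟨by linarith [(abs_nonneg z).trans_lt hzr], (abs_nonneg z).trans_lt hzr⟩
    · simp
  convert hd using 1
  rw [← ((hasSum_pow_div_log_of_abs_lt_one hz).div_const z).tsum_eq]
  congr 1 with k
  field_simp
  ring

theorem eq_of_hasDerivAt_zero_of_tendsto {f : ℝ → ℝ} {a b c x : ℝ}
    (hf : ∀ y ∈ Ioo a b, HasDerivAt f 0 y) (hc : Tendsto f (𝓝[>] a) (𝓝 c))
    (hx : x ∈ Ioo a b) : f x = c := by
  refine tendsto_nhds_unique (tendsto_const_nhds.congr' ?_) hc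
  filter_upwards [Ioo_mem_nhdsGT (hx.1.trans hx.2)] with y hy
  exact isOpen_Ioo.is_const_of_deriv_eq_zero isPreconnected_Ioo
    (fun y hy => (hf y hy).differentiableAt.differentiableWithinAt)
    (fun y hy => (hf y hy).deriv) hx hy

theorem tendsto_log_mul_of_hasDerivAt {g : ℝ → ℝ} {c : ℝ} (hg : HasDerivAt g c 0)
    (hg0 : g 0 = 0) : Tendsto (fun x => log x * g x) (𝓝[>] 0) (𝓝 0) := by
  have h1 : Tendsto (fun x => log x * x) (𝓝[>] 0) (𝓝 0) := by
    simpa [mul_comm] using (continuous_mul_log.tendsto 0).mono_left nhdsWithin_le_nhds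
  have h2 : Tendsto (slope g 0) (𝓝[>] 0) (𝓝 c) :=
    hg.tendsto_slope.mono_left (nhdsWithin_mono _ fun x hx => ne_of_gt hx)
  have h := h1.mul h2
  rw [zero_mul] at h
  refine h.congr' ?_
  filter_upwards [self_mem_nhdsWithin] with x hx
  have : x ≠ 0 := ne_of_gt hx
  rw [slope_def_field, hg0]
  field_simp
  ring

theorem tendsto_Li2_comp {g : ℝ → ℝ} {s : Set ℝ} {a : ℝ} (hg : ContinuousWithinAt g s a)
    (ha : g a ∈ Icc (-1 : ℝ) 1) (hs : ∀ᶠ x in 𝓝[s] a, g x ∈ Icc (-1 : ℝ) 1) :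
    Tendsto (fun x => Li2 (g x)) (𝓝[s] a) (𝓝 (Li2 (g a))) :=
  (continuousOn_Li2 _ ha).tendsto.comp (tendsto_nhdsWithin_iff.2 ⟨hg, hs⟩)

/-- Landen's identity. -/
theorem Li2_add_Li2_div_sub_one {z : ℝ} (hz : z ∈ Ioo (0 : ℝ) (1 / 2)) :
    Li2 z + Li2 (z / (z - 1)) = -(1 / 2) * log (1 - z) ^ 2 := by
  have key := eq_of_hasDerivAt_zero_of_tendsto (c := 0)
    (f := fun z => Li2 z + Li2 (z / (z - 1)) + (1 / 2) * log (1 - z) ^ 2) ?_ ?_ hz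
  · linarith
  · rintro y ⟨hy0, hy1⟩
    have h1 : y - 1 ≠ 0 := by linarith
    have h1' : 1 - y ≠ 0 := by linarith
    have hw : |y / (y - 1)| < 1 := by
      rw [abs_div, abs_of_pos hy0, abs_of_neg (by linarith : y - 1 < 0),
        div_lt_one (by linarith)]
      linarith
    have d1 := hasDerivAt_Li2 (abs_lt.2 ⟨by linarith, by linarith⟩ : |y| < 1) hy0.ne'
    have d2 := (hasDerivAt_Li2 hw (div_ne_zero hy0.ne' h1)).comp y
      ((hasDerivAt_id y).div ((hasDerivAt_id y).sub_const 1) h1)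
    have d3 := (((((hasDerivAt_id y).const_sub 1).log h1').pow 2).const_mul (1 / 2))
    convert! (d1.add d2).add d3 using 1
    have e : log (1 - y / (y - 1)) = -log (1 - y) := by
      rw [← log_inv]
      congr 1
      field_simp
      ring
    simp only [id, e]
    have h2 : y - 1 = -(1 - y) := by ring
    rw [h2]
    field_simp
    ring
  · have hU : ∀ᶠ x in 𝓝[>] (0 : ℝ), x ∈ Ioo (0 : ℝ) (1 / 2) := Ioo_mem_nhdsGT (by norm_num)
    have t1 := tendsto_Li2_comp (g := fun x => x) (s := Ioi 0) (a := 0) continuousWithinAt_id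
      (by simp) (hU.mono fun x hx => ⟨by linarith [hx.1], by linarith [hx.2]⟩)
    have t2 := tendsto_Li2_comp (g := fun x => x / (x - 1)) (s := Ioi 0) (a := 0)
      (ContinuousAt.continuousWithinAt (by fun_prop (disch := norm_num)))
      (by simp) (hU.mono fun x hx => by
        have : x - 1 < 0 := by linarith [hx.2]
        constructor
        · rw [le_div_iff_of_neg this]
          linarith [hx.2]
        · rw [div_le_iff_of_neg this]
          linarith [hx.1])
    have t3 : Tendsto (fun z : ℝ => (1 / 2) * log (1 - z) ^ 2) (𝓝[>] 0)
        (𝓝 ((1 / 2) * log (1 - 0) ^ 2)) :=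
      (ContinuousAt.continuousWithinAt (by fun_prop (disch := norm_num)) :
        ContinuousWithinAt (fun z : ℝ => (1 / 2) * log (1 - z) ^ 2) (Ioi 0) 0)
    simpa [Li2_zero] using (t1.add t2).add t3

/-- Euler's reflection formula. -/
theorem Li2_add_Li2_one_sub {x : ℝ} (hx : x ∈ Ioo (0 : ℝ) 1) :
    Li2 x + Li2 (1 - x) = π ^ 2 / 6 - log x * log (1 - x) := by
  have key := eq_of_hasDerivAt_zero_of_tendsto (c := π ^ 2 / 6)
    (f := fun x => Li2 x + Li2 (1 - x) + log x * log (1 - x)) ?_ ?_ hx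
  · linarith
  · rintro y ⟨hy0, hy1⟩
    have h1 : 1 - y ≠ 0 := by linarith
    have d0 := (hasDerivAt_id y).const_sub 1
    have d1 := hasDerivAt_Li2 (abs_lt.2 ⟨by linarith, by linarith⟩ : |y| < 1) hy0.ne'
    have d2 := (hasDerivAt_Li2 (abs_lt.2 ⟨by linarith, by linarith⟩ : |1 - y| < 1) h1).comp y d0
    have d3 := (hasDerivAt_log hy0.ne').mul (d0.log h1)
    convert! (d1.add d2).add d3 using 1
    simp only [id, sub_sub_cancel]
    field_simp
    ring
  · have hU : ∀ᶠ x in 𝓝[>] (0 : ℝ), x ∈ Ioo (0 : ℝ) 1 := Ioo_mem_nhdsGT (by norm_num)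
    have t1 := tendsto_Li2_comp (g := fun x => x) (s := Ioi 0) (a := 0) continuousWithinAt_id
      (by simp) (hU.mono fun x hx => ⟨by linarith [hx.1], by linarith [hx.2]⟩)
    have t2 := tendsto_Li2_comp (g := fun x => 1 - x) (s := Ioi 0) (a := 0)
      (ContinuousAt.continuousWithinAt (by fun_prop))
      (by simp) (hU.mono fun x hx => ⟨by linarith [hx.2], by linarith [hx.1]⟩)
    have t3 := tendsto_log_mul_of_hasDerivAt
      (((hasDerivAt_id (0 : ℝ)).const_sub 1).log (by simp)) (by simp)
    simpa [Li2_zero, Li2_one] using (t1.add t2).add t3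

/-- Landen's identity for the Legendre chi function `(Li₂ x - Li₂ (-x)) / 2`. -/
theorem Li2_sub_Li2_neg_add {x : ℝ} (hx : x ∈ Ioo (0 : ℝ) 1) :
    Li2 ((1 - x) / (1 + x)) - Li2 (-((1 - x) / (1 + x))) + (Li2 x - Li2 (-x)) =
      π ^ 2 / 4 + log x * (log (1 + x) - log (1 - x)) := by
  have key := eq_of_hasDerivAt_zero_of_tendsto (c := π ^ 2 / 4)
    (f := fun x => Li2 ((1 - x) / (1 + x)) - Li2 (-((1 - x) / (1 + x))) + (Li2 x - Li2 (-x)) -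
      log x * (log (1 + x) - log (1 - x))) ?_ ?_ hx
  · linarith
  · rintro y ⟨hy0, hy1⟩
    have h1 : 1 - y ≠ 0 := by linarith
    have h2 : 1 + y ≠ 0 := by linarith
    have hw0 : (1 - y) / (1 + y) ≠ 0 := div_ne_zero h1 h2
    have hw : |(1 - y) / (1 + y)| < 1 := by
      rw [abs_div, abs_of_pos (by linarith : 0 < 1 - y), abs_of_pos (by linarith : 0 < 1 + y),
        div_lt_one (by linarith)]
      linarith
    have hy : |y| < 1 := abs_lt.2 ⟨by linarith, by linarith⟩
    have dm := (hasDerivAt_id y).const_sub 1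
    have dp := (hasDerivAt_id y).const_add 1
    have dw := dm.div dp h2
    have d1 := (hasDerivAt_Li2 hw hw0).comp y dw
    have d2 := (hasDerivAt_Li2 (by rwa [abs_neg]) (neg_ne_zero.2 hw0)).comp y dw.neg
    have d3 := hasDerivAt_Li2 hy hy0.ne'
    have d4 := (hasDerivAt_Li2 (by rwa [abs_neg]) (neg_ne_zero.2 hy0.ne')).comp y
      (hasDerivAt_id y).neg
    have d5 := (hasDerivAt_log hy0.ne').mul ((dp.log h2).sub (dm.log h1))
    convert! ((d1.sub d2).add (d3.sub d4)).sub d5 using 1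
    have e1 : log (1 - (1 - y) / (1 + y)) = log 2 + log y - log (1 + y) := by
      rw [← log_mul two_ne_zero hy0.ne', ← log_div (by positivity) h2]
      congr 1
      field_simp
      ring
    have e2 : log (1 + (1 - y) / (1 + y)) = log 2 - log (1 + y) := by
      rw [← log_div two_ne_zero h2]
      congr 1
      field_simp
      ring
    simp only [id, sub_neg_eq_add, e1, e2, Pi.sub_apply]
    field_simp
    ring
  · have hU : ∀ᶠ x in 𝓝[>] (0 : ℝ), x ∈ Ioo (0 : ℝ) 1 := Ioo_mem_nhdsGT (by norm_num)
    have hw : ∀ x ∈ Ioo (0 : ℝ) 1, 0 ≤ (1 - x) / (1 + x) ∧ (1 - x) / (1 + x) ≤ 1 := by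
      rintro x ⟨h0, h1⟩
      exact ⟨div_nonneg (by linarith) (by linarith), (div_le_one (by linarith)).2 (by linarith)⟩
    have t1 := tendsto_Li2_comp (g := fun x => (1 - x) / (1 + x)) (s := Ioi 0) (a := 0)
      (ContinuousAt.continuousWithinAt (by fun_prop (disch := norm_num)))
      (by simp) (hU.mono fun x hx => ⟨by linarith [(hw x hx).1], (hw x hx).2⟩)
    have t2 := tendsto_Li2_comp (g := fun x => -((1 - x) / (1 + x))) (s := Ioi 0) (a := 0)
      (ContinuousAt.continuousWithinAt (by fun_prop (disch := norm_num)))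
      (by simp) (hU.mono fun x hx => ⟨by linarith [(hw x hx).2], by linarith [(hw x hx).1]⟩)
    have t3 := tendsto_Li2_comp (g := fun x => x) (s := Ioi 0) (a := 0) continuousWithinAt_id
      (by simp) (hU.mono fun x hx => ⟨by linarith [hx.1], by linarith [hx.2]⟩)
    have t4 := tendsto_Li2_comp (g := fun x => -x) (s := Ioi 0) (a := 0)
      (ContinuousAt.continuousWithinAt (by fun_prop))
      (by simp) (hU.mono fun x hx => ⟨by linarith [hx.2], by linarith [hx.1]⟩)
    have t5 := tendsto_log_mul_of_hasDerivAt
      ((((hasDerivAt_id (0 : ℝ)).const_add 1).log (by simp)).sub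
        (((hasDerivAt_id (0 : ℝ)).const_sub 1).log (by simp))) (by simp)
    convert! ((t1.sub t2).add (t3.sub t4)).sub t5 using 2
    simp only [sub_zero, add_zero, div_one, neg_zero, Li2_zero, Li2_one, Li2_neg_one]
    ring

theorem stmt_19 :
    Li2 (1 / 4) + (1 / 3) * Li2 (1 / 9) =
      Real.pi ^ 2 / 18 + 2 * Real.log 2 * Real.log 3 - 2 * (Real.log 2) ^ 2 -
        (2 / 3) * (Real.log 3) ^ 2 := by
  have l4 : log 4 = 2 * log 2 := by
    rw [show (4 : ℝ) = 2 ^ 2 by norm_num, log_pow]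
    norm_num
  have landen_quarter := Li2_add_Li2_div_sub_one (z := 1 / 4) ⟨by norm_num, by norm_num⟩
  have landen_third := Li2_add_Li2_div_sub_one (z := 1 / 3) ⟨by norm_num, by norm_num⟩
  have reflection := Li2_add_Li2_one_sub (x := 1 / 2) ⟨by norm_num, by norm_num⟩
  have chi := Li2_sub_Li2_neg_add (x := 1 / 2) ⟨by norm_num, by norm_num⟩
  have dup := Li2_sq (x := 1 / 3) ⟨by norm_num, by norm_num⟩
  rw [show (1 / 4 : ℝ) / (1 / 4 - 1) = -(1 / 3) by norm_num,
    show (1 : ℝ) - 1 / 4 = 3 / 4 by norm_num, log_div (by norm_num) (by norm_num), l4]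
    at landen_quarter
  rw [show (1 / 3 : ℝ) / (1 / 3 - 1) = -(1 / 2) by norm_num,
    show (1 : ℝ) - 1 / 3 = 2 / 3 by norm_num, log_div (by norm_num) (by norm_num)] at landen_third
  rw [show (1 : ℝ) - 1 / 2 = 1 / 2 by norm_num, log_div (by norm_num) (by norm_num), log_one]
    at reflection
  rw [show (1 - 1 / 2 : ℝ) / (1 + 1 / 2) = 1 / 3 by norm_num,
    show (1 : ℝ) - 1 / 2 = 1 / 2 by norm_num, show (1 : ℝ) + 1 / 2 = 3 / 2 by norm_num,
    log_div (by norm_num) (by norm_num), log_div (by norm_num) (by norm_num), log_one] at chi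
  rw [show (1 / 3 : ℝ) ^ 2 = 1 / 9 by norm_num] at dup
  linear_combination landen_quarter + (1 / 3) * dup + (1 / 3) * chi +
    (1 / 3) * landen_third - (1 / 6) * reflection
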